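/- For all n ≥ 1, the polynomial identity Σ_{σ ∈ D_{2n}} t^{c(σ)} = Σ_f t^{mo(f) + fd(f) + fi(f)} holds, where the left sum is over all D-permutations σ on [2n] with c(σ) the number of cycles of σ, and the right sum is over all surjective staircases f ∈ E_{2n+2} with me(f) = 0 (no even maxima). Equivalently, Σ_{σ ∈ D_{2n}} t^{c(σ)} = Λ_{2n+2}(t,t,1,0,t,1), where Λ_{2m}(x,y,z,x̄,ȳ,z̄) = Σ_{f ∈ E_{2m}} x^{mo(f)} y^{fd(f)} z^{si(f)} x̄^{me(f)} ȳ^{fi(f)} z̄^{sd(f)} is the generalized Dumont–Foata polynomial. -/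

import Mathlib

open Finset

/-- The Ferrers graph on vertex set `V ⊆ ℕ`: edges `{u,v}` with `u < v`, `u` odd, `v` even. -/
def ferrers (V : Finset ℕ) : SimpleGraph ℕ :=
  SimpleGraph.fromRel (fun u v => u ∈ V ∧ v ∈ V ∧ u < v ∧ Odd u ∧ Even v)

/-- A partition of `V` is a bond partition if each block induces a connected subgraph. -/
def IsBond (V : Finset ℕ) (P : Finpartition V) : Prop :=
  ∀ B ∈ P.parts, ((ferrers V).induce (B : Set ℕ)).Connected

/-- `u` is a (strict) descendant of `v` in the graph `G` rooted (componentwise) at `r`. -/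
def DescOf {α : Type*} (G : SimpleGraph α) (r v u : α) : Prop :=
  u ≠ v ∧ G.Reachable u r ∧ ∀ p : G.Walk u r, v ∈ p.support

/-- `F` is an increasing-decreasing (ID) forest. -/
def IsIDForest (V : Finset ℕ) (F : SimpleGraph {x // x ∈ V}) : Prop :=
  F.IsAcyclic ∧
  ∀ r v : {x // x ∈ V}, F.Reachable v r → (∀ u, F.Reachable v u → (u : ℕ) ≤ (r : ℕ)) →
    (Odd (v : ℕ) →
      (∀ u, DescOf F r v u → (v : ℕ) < (u : ℕ)) ∧
      (∀ u, F.Adj v u → DescOf F r v u → Even (u : ℕ))) ∧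
    (Even (v : ℕ) →
      (∀ u, DescOf F r v u → (u : ℕ) < (v : ℕ)) ∧
      (∀ u, F.Adj v u → DescOf F r v u → Odd (u : ℕ)))

/-- `T` is an increasing-decreasing (ID) tree. -/
def IsIDTree (V : Finset ℕ) (T : SimpleGraph {x // x ∈ V}) : Prop :=
  T.Connected ∧ IsIDForest V T

/-- A D-permutation on `A`. -/
def IsDPerm (A : Finset ℕ) (σ : Equiv.Perm {x // x ∈ A}) : Prop :=
  ∀ i : {x // x ∈ A}, (Odd (i : ℕ) → (i : ℕ) ≤ (σ i : ℕ)) ∧ (Even (i : ℕ) → (σ i : ℕ) ≤ (i : ℕ))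

/-- A D-cycle on `A`: a D-permutation which is a single cycle covering `A`. -/
def IsDCycle (A : Finset ℕ) (σ : Equiv.Perm {x // x ∈ A}) : Prop :=
  IsDPerm A σ ∧ ∀ x y : {x // x ∈ A}, σ.SameCycle x y

/-- The number of cycles (orbits, fixed points included) of a permutation. -/
noncomputable def cycleCount {α : Type*} (σ : Equiv.Perm α) : ℕ :=
  Nat.card (Quotient (⟨σ.SameCycle, Equiv.Perm.SameCycle.equivalence σ⟩ : Setoid α))

/-- A Dumont permutation on `A` (intended for `A = [2m]`). -/
def IsDumontPerm (A : Finset ℕ) (σ : Equiv.Perm {x // x ∈ A}) : Prop :=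
  ∀ i : {x // x ∈ A}, (Even (i : ℕ) → (σ i : ℕ) < (i : ℕ)) ∧ (Odd (i : ℕ) → (i : ℕ) ≤ (σ i : ℕ))

/-- A Dumont derangement on `A` (intended for `A = [2m]`). -/
def IsDumontDerangement (A : Finset ℕ) (σ : Equiv.Perm {x // x ∈ A}) : Prop :=
  ∀ i : {x // x ∈ A}, (Even (i : ℕ) → (σ i : ℕ) < (i : ℕ)) ∧ (Odd (i : ℕ) → (i : ℕ) < (σ i : ℕ))

/-- The Genocchi number `g n`: the number of Dumont permutations on `[2n-2]`. -/
noncomputable def genocchi (n : ℕ) : ℕ :=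
  Nat.card {σ : Equiv.Perm {x // x ∈ Finset.Icc 1 (2 * n - 2)} // IsDumontPerm _ σ}

/-- The median Genocchi number `h n`: the number of Dumont derangements on `[2n+2]`. -/
noncomputable def medianGenocchi (n : ℕ) : ℕ :=
  Nat.card {σ : Equiv.Perm {x // x ∈ Finset.Icc 1 (2 * n + 2)} // IsDumontDerangement _ σ}

/-- A surjective staircase on `[m]` (intended for even `m`): an excedent function whose image
is exactly the set of even elements of `[m]`. -/
def IsSurjStaircase (m : ℕ) (f : {x // x ∈ Finset.Icc 1 m} → {x // x ∈ Finset.Icc 1 m}) :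
    Prop :=
  (∀ i : {x // x ∈ Finset.Icc 1 m}, (i : ℕ) ≤ (f i : ℕ)) ∧
    ∀ j : {x // x ∈ Finset.Icc 1 m}, (Even (j : ℕ) ↔ ∃ i, f i = j)

open scoped Classical

/-- The number of odd maxima of a surjective staircase on `[2n+2]`. -/
noncomputable def moCount (n : ℕ)
    (f : {x // x ∈ Finset.Icc 1 (2 * n + 2)} → {x // x ∈ Finset.Icc 1 (2 * n + 2)}) : ℕ :=
  (Finset.univ.filter fun j : {x // x ∈ Finset.Icc 1 (2 * n + 2)} =>
    (j : ℕ) ≤ 2 * n ∧ Odd (j : ℕ) ∧ (f j : ℕ) = 2 * n + 2).card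

/-- The number of even maxima of a surjective staircase on `[2n+2]`. -/
noncomputable def meCount (n : ℕ)
    (f : {x // x ∈ Finset.Icc 1 (2 * n + 2)} → {x // x ∈ Finset.Icc 1 (2 * n + 2)}) : ℕ :=
  (Finset.univ.filter fun j : {x // x ∈ Finset.Icc 1 (2 * n + 2)} =>
    (j : ℕ) ≤ 2 * n ∧ Even (j : ℕ) ∧ (f j : ℕ) = 2 * n + 2).card

/-- The number of doubled fixed points of a surjective staircase on `[2n+2]`. -/
noncomputable def fdCount (n : ℕ)
    (f : {x // x ∈ Finset.Icc 1 (2 * n + 2)} → {x // x ∈ Finset.Icc 1 (2 * n + 2)}) : ℕ :=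
  (Finset.univ.filter fun j : {x // x ∈ Finset.Icc 1 (2 * n + 2)} =>
    (j : ℕ) ≤ 2 * n ∧ f j = j ∧ ∃ i, i ≠ j ∧ f i = j).card

/-- The number of isolated fixed points of a surjective staircase on `[2n+2]`. -/
noncomputable def fiCount (n : ℕ)
    (f : {x // x ∈ Finset.Icc 1 (2 * n + 2)} → {x // x ∈ Finset.Icc 1 (2 * n + 2)}) : ℕ :=
  (Finset.univ.filter fun j : {x // x ∈ Finset.Icc 1 (2 * n + 2)} =>
    (j : ℕ) ≤ 2 * n ∧ f j = j ∧ ∀ i, f i = j → i = j).card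

section Cycles

variable {α β : Type*}

/-- The setoid of cycles of a permutation. -/
def cycleSetoid (σ : Equiv.Perm α) : Setoid α :=
  ⟨σ.SameCycle, Equiv.Perm.SameCycle.equivalence σ⟩

theorem eq_of_sameCycle {σ : Equiv.Perm α} {g : α → β} (hg : ∀ z, g (σ z) = g z) {x y : α}
    (h : σ.SameCycle x y) : g x = g y := by
  obtain ⟨i, rfl⟩ := h
  induction i using Int.induction_on with
  | zero => simp
  | succ i ih => rw [ih, add_comm, zpow_add, zpow_one, Equiv.Perm.mul_apply, hg]
  | pred i ih =>
    rw [ih, ← hg ((σ ^ (-(i : ℤ) - 1)) x), ← Equiv.Perm.mul_apply, ← zpow_one_add]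
    congr 3
    ring

theorem cycleSetoid_mk_apply (σ : Equiv.Perm α) (x : α) :
    Quotient.mk (cycleSetoid σ) (σ x) = Quotient.mk (cycleSetoid σ) x :=
  Quotient.sound (s := cycleSetoid σ) (Equiv.Perm.sameCycle_apply_left.2 (.refl σ x))

theorem cycleCount_permCongr (e : α ≃ β) (σ : Equiv.Perm α) :
    cycleCount (e.permCongr σ) = cycleCount σ := by
  refine Nat.card_congr
    ⟨Quotient.lift (fun z => Quotient.mk (cycleSetoid σ) (e.symm z)) fun _ _ h =>
        eq_of_sameCycle (σ := e.permCongr σ)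
          (g := fun z => Quotient.mk (cycleSetoid σ) (e.symm z)) (fun z => ?_) h,
      Quotient.lift (fun z => Quotient.mk (cycleSetoid (e.permCongr σ)) (e z)) fun _ _ h =>
        eq_of_sameCycle (σ := σ)
          (g := fun z => Quotient.mk (cycleSetoid (e.permCongr σ)) (e z)) (fun z => ?_) h, ?_, ?_⟩
  · simpa using cycleSetoid_mk_apply σ (e.symm z)
  · simpa using cycleSetoid_mk_apply (e.permCongr σ) (e z)
  · rintro ⟨z⟩
    exact congrArg (Quotient.mk _) (e.apply_symm_apply z)
  · rintro ⟨z⟩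
    exact congrArg (Quotient.mk _) (e.symm_apply_apply z)

theorem cycleCount_optionCongr [Finite α] (σ : Equiv.Perm α) :
    cycleCount (Equiv.optionCongr σ) = cycleCount σ + 1 := by
  rw [cycleCount, cycleCount, ← Finite.card_option]
  refine Nat.card_congr
    ⟨Quotient.lift (fun z => z.map (Quotient.mk (cycleSetoid σ))) fun _ _ h =>
        eq_of_sameCycle (σ := Equiv.optionCongr σ) (fun z => ?_) h,
      fun o => o.elim (Quotient.mk _ none)
        (Quotient.lift (fun z => Quotient.mk (cycleSetoid (Equiv.optionCongr σ)) (some z))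
          fun _ _ h => eq_of_sameCycle (σ := σ)
            (g := fun z => Quotient.mk (cycleSetoid (Equiv.optionCongr σ)) (some z))
            (fun z => ?_) h), ?_, ?_⟩
  · cases z with
    | none => rfl
    | some x => exact congrArg some (cycleSetoid_mk_apply σ x)
  · exact cycleSetoid_mk_apply (Equiv.optionCongr σ) (some z)
  · rintro ⟨_ | z⟩ <;> rfl
  · rintro (_ | z)
    · rfl
    · induction z using Quotient.inductionOn
      rfl

theorem swap_none_mul_optionCongr_none [DecidableEq α] (σ : Equiv.Perm α) (i : Option α) :
    (Equiv.swap none i * Equiv.optionCongr σ) none = i := by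
  simp

theorem swap_none_mul_optionCongr_some [DecidableEq α] (σ : Equiv.Perm α) (a x : α) :
    (Equiv.swap none (some a) * Equiv.optionCongr σ) (some x) =
      if σ x = a then none else some (σ x) := by
  simp [Equiv.swap_apply_def]

theorem cycleCount_swap_none_mul [DecidableEq α] (σ : Equiv.Perm α) (a : α) :
    cycleCount (Equiv.swap none (some a) * Equiv.optionCongr σ) = cycleCount σ := by
  set τ := Equiv.swap none (some a) * Equiv.optionCongr σ with hτ
  have h_none : τ none = some a := swap_none_mul_optionCongr_none σ _
  have h_some : ∀ x, τ (some x) = if σ x = a then none else some (σ x) :=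
    swap_none_mul_optionCongr_some σ a
  have h_mk : Quotient.mk (cycleSetoid τ) (some a) = Quotient.mk (cycleSetoid τ) none := by
    rw [← h_none, cycleSetoid_mk_apply]
  refine Nat.card_congr
    ⟨Quotient.lift (fun z => Quotient.mk (cycleSetoid σ) (z.getD a)) fun _ _ h =>
        eq_of_sameCycle (σ := τ) (g := fun z => Quotient.mk (cycleSetoid σ) (z.getD a)) (fun z => ?_) h,
      Quotient.lift (fun z => Quotient.mk (cycleSetoid τ) (some z)) fun _ _ h =>
        eq_of_sameCycle (σ := σ) (g := fun z => Quotient.mk (cycleSetoid τ) (some z))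
          (fun z => ?_) h, ?_, ?_⟩
  · cases z with
    | none => simp [h_none]
    | some x =>
      rw [h_some]
      split_ifs with hx
      · rw [Option.getD_none, ← hx, cycleSetoid_mk_apply]; rfl
      · exact cycleSetoid_mk_apply σ x
  · rw [← cycleSetoid_mk_apply τ (some z), h_some]
    split_ifs with hx
    · rw [hx, h_mk]
    · rfl
  · rintro ⟨_ | z⟩
    · exact h_mk
    · rfl
  · rintro ⟨z⟩
    rfl

end Cycles

section PermSum

open Polynomial

variable {α β : Type*} [Fintype α] [DecidableEq α] [Fintype β] [DecidableEq β]

/-- The cycle polynomial of the permutations all of whose arcs `x ↦ σ x` satisfy `R`. -/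
noncomputable def permSum (R : α → α → Prop) : ℤ[X] :=
  ∑ σ : Equiv.Perm α with ∀ x, R x (σ x), X ^ cycleCount σ

theorem permSum_congr (e : α ≃ β) {R : α → α → Prop} {R' : β → β → Prop}
    (h : ∀ x y, R x y ↔ R' (e x) (e y)) : permSum R = permSum R' := by
  refine Finset.sum_equiv e.permCongr (fun σ => ?_) fun σ _ => by rw [cycleCount_permCongr]
  simp only [Finset.mem_filter, Finset.mem_univ, true_and, h]
  exact ⟨fun H y => by simpa using H (e.symm y), fun H x => by simpa using H (e x)⟩

theorem permSum_fiber {R : Option α → Option α → Prop} (i : Option α) (hi : R none i)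
    (twin : ∀ a, i = some a → ∀ x, R (some x) none ↔ R (some x) (some a)) :
    (∑ σ : Equiv.Perm (Option α) with (∀ x, R x (σ x)) ∧ σ none = i,
        (X : ℤ[X]) ^ cycleCount σ) =
      (if i = none then X else 1) * permSum fun x y => R (some x) (some y) := by
  rw [permSum, Finset.mul_sum]
  symm
  refine Finset.sum_bij (fun σ _ => Equiv.swap none i * Equiv.optionCongr σ) ?_ ?_ ?_ ?_
  · intro σ hσ
    simp only [Finset.mem_filter, Finset.mem_univ, true_and] at hσ ⊢
    refine ⟨?_, swap_none_mul_optionCongr_none σ i⟩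
    rintro (_ | x)
    · rwa [swap_none_mul_optionCongr_none]
    · cases i with
      | none => simpa using hσ x
      | some a =>
        rw [swap_none_mul_optionCongr_some]
        split_ifs with hx
        · rw [twin a rfl, ← hx]
          exact hσ x
        · exact hσ x
  · intro σ _ τ _ h
    exact Equiv.optionCongr_injective (mul_left_cancel h)
  · intro τ hτ
    simp only [Finset.mem_filter, Finset.mem_univ, true_and] at hτ
    obtain ⟨⟨j, σ⟩, rfl⟩ := (Equiv.Perm.decomposeOption (α := α)).symm.surjective τ
    simp only [Equiv.Perm.decomposeOption_symm_apply] at hτ ⊢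
    obtain rfl : j = i := by rw [← hτ.2, swap_none_mul_optionCongr_none]
    refine ⟨σ, ?_, rfl⟩
    simp only [Finset.mem_filter, Finset.mem_univ, true_and]
    intro x
    have hx := hτ.1 (some x)
    cases j with
    | none => simpa using hx
    | some a =>
      rw [swap_none_mul_optionCongr_some] at hx
      split_ifs at hx with h
      · rw [h, ← twin a rfl]
        exact hx
      · exact hx
  · intro σ _
    cases i with
    | none =>
      have h : Equiv.swap none none * Equiv.optionCongr σ = Equiv.optionCongr σ := by
        rw [Equiv.swap_self]; rfl
      rw [h, cycleCount_optionCongr, pow_succ', if_pos rfl]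
    | some a => rw [cycleCount_swap_none_mul, if_neg (by simp), one_mul]

theorem permSum_option (R : Option α → Option α → Prop) :
    permSum R = ∑ i, ∑ σ : Equiv.Perm (Option α) with (∀ x, R x (σ x)) ∧ σ none = i,
      (X : ℤ[X]) ^ cycleCount σ := by
  rw [permSum, ← Finset.sum_fiberwise _ fun σ => σ none]
  simp only [Finset.filter_filter]

/-- If `none` is interchangeable, as a target, with each of its possible images, it can be removed
from the permutations counted by `permSum`. -/
theorem permSum_option_of_twin {R : Option α → Option α → Prop}
    (twin : ∀ a, R none (some a) → ∀ x, R (some x) none ↔ R (some x) (some a)) :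
    permSum R = (∑ i with R none i, if i = none then X else 1) *
      permSum fun x y => R (some x) (some y) := by
  rw [permSum_option, Finset.sum_mul, Finset.sum_filter]
  refine Finset.sum_congr rfl fun i _ => ?_
  split_ifs with hi
  · subst_vars
    exact permSum_fiber _ hi (by simp)
  · rw [permSum_fiber i hi (by rintro a rfl; exact twin a hi)]
    simp [*]
  · refine Finset.sum_eq_zero fun σ hσ => absurd ?_ hi
    simp only [Finset.mem_filter, Finset.mem_univ, true_and] at hσ
    rw [← hσ.2]
    exact hσ.1 none

end PermSum

section WildPoints

open Polynomial

/-- The arcs allowed in a D-permutation of `p` points (numbered from `0`, so that parities are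
exchanged) extended by `k` larger points on which no condition is imposed. -/
def dRel (p k : ℕ) : Fin p ⊕ Fin k → Fin p ⊕ Fin k → Prop
  | .inl i, .inl j => (Even (i : ℕ) → i ≤ j) ∧ (Odd (i : ℕ) → j ≤ i)
  | .inl i, .inr _ => Even (i : ℕ)
  | .inr _, _ => True

section Rel

variable {p k : ℕ}

@[simp] theorem dRel_inl_inl (i j : Fin p) :
    dRel p k (.inl i) (.inl j) ↔ (Even (i : ℕ) → i ≤ j) ∧ (Odd (i : ℕ) → j ≤ i) := Iff.rfl
@[simp] theorem dRel_inl_inr (i : Fin p) (a : Fin k) :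
    dRel p k (.inl i) (.inr a) ↔ Even (i : ℕ) := Iff.rfl
@[simp] theorem dRel_inr (a : Fin k) (x : Fin p ⊕ Fin k) : dRel p k (.inr a) x ↔ True := Iff.rfl

end Rel

/-- The cycle polynomial of D-permutations of `p` points extended by `k` unconstrained points. -/
noncomputable def dSum (p k : ℕ) : ℤ[X] := permSum (dRel p k)

/-- The last constrained point is singled out as `none`. -/
noncomputable def optionEquivLeft (p k : ℕ) : Option (Fin p ⊕ Fin k) ≃ Fin (p + 1) ⊕ Fin k :=
  Equiv.ofBijective
    (fun o => o.elim (.inl (Fin.last p)) (Sum.map Fin.castSucc id)) <| by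
    constructor
    · rintro (_ | _ | _) (_ | _ | _) <;> simp [Fin.castSucc_ne_last, (Fin.castSucc_ne_last _).symm]
    · rintro (i | a)
      · cases i using Fin.lastCases with
        | last => exact ⟨none, rfl⟩
        | cast i => exact ⟨some (.inl i), rfl⟩
      · exact ⟨some (.inr a), rfl⟩

/-- The last unconstrained point is singled out as `none`. -/
noncomputable def optionEquivRight (p k : ℕ) : Option (Fin p ⊕ Fin k) ≃ Fin p ⊕ Fin (k + 1) :=
  Equiv.ofBijective
    (fun o => o.elim (.inr (Fin.last k)) (Sum.map id Fin.castSucc)) <| by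
    constructor
    · rintro (_ | _ | _) (_ | _ | _) <;> simp [Fin.castSucc_ne_last, (Fin.castSucc_ne_last _).symm]
    · rintro (i | a)
      · exact ⟨some (.inl i), rfl⟩
      · cases a using Fin.lastCases with
        | last => exact ⟨none, rfl⟩
        | cast a => exact ⟨some (.inr a), rfl⟩

section Apply

variable (p k : ℕ)

@[simp] theorem optionEquivLeft_none : optionEquivLeft p k none = .inl (Fin.last p) := rfl
@[simp] theorem optionEquivLeft_inl (i : Fin p) :
    optionEquivLeft p k (some (.inl i)) = .inl i.castSucc := rfl
@[simp] theorem optionEquivLeft_inr (a : Fin k) :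
    optionEquivLeft p k (some (.inr a)) = .inr a := rfl
@[simp] theorem optionEquivRight_none : optionEquivRight p k none = .inr (Fin.last k) := rfl
@[simp] theorem optionEquivRight_inl (i : Fin p) :
    optionEquivRight p k (some (.inl i)) = .inl i := rfl
@[simp] theorem optionEquivRight_inr (a : Fin k) :
    optionEquivRight p k (some (.inr a)) = .inr a.castSucc := rfl

end Apply

theorem permSum_dRel (p k : ℕ) : (permSum fun x y => dRel p k x y) = dSum p k := rfl

theorem dSum_succ_left (p k : ℕ) :
    dSum (p + 1) k =
      permSum fun x y => dRel (p + 1) k (optionEquivLeft p k x) (optionEquivLeft p k y) :=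
  (permSum_congr (optionEquivLeft p k) fun _ _ => Iff.rfl).symm

theorem dSum_succ_right (p k : ℕ) :
    dSum p (k + 1) =
      permSum fun x y => dRel p (k + 1) (optionEquivRight p k x) (optionEquivRight p k y) :=
  (permSum_congr (optionEquivRight p k) fun _ _ => Iff.rfl).symm

theorem dRel_optionEquivLeft_some (p k : ℕ) (x y : Fin p ⊕ Fin k) :
    dRel (p + 1) k (optionEquivLeft p k (some x)) (optionEquivLeft p k (some y)) ↔
      dRel p k x y := by
  rcases x with _ | _ <;> rcases y with _ | _ <;> simp 

theorem dRel_optionEquivRight_some (p k : ℕ) (x y : Fin p ⊕ Fin k) :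
    dRel p (k + 1) (optionEquivRight p k (some x)) (optionEquivRight p k (some y)) ↔
      dRel p k x y := by
  rcases x with _ | _ <;> rcases y with _ | _ <;> simp 

theorem dSum_zero_zero : dSum 0 0 = 1 := by
  have h : cycleCount (1 : Equiv.Perm (Fin 0 ⊕ Fin 0)) = 0 := by
    rw [cycleCount, Nat.card_eq_zero]
    exact .inl ⟨fun q => Quotient.inductionOn q isEmptyElim⟩
  rw [dSum, permSum, Finset.filter_true_of_mem fun _ _ x => isEmptyElim x,
    Fintype.sum_subsingleton _ 1, h, pow_zero]

theorem dSum_zero_succ (k : ℕ) : dSum 0 (k + 1) = (X + (k : ℤ[X])) * dSum 0 k := by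
  rw [dSum_succ_right, permSum_option_of_twin]
  · simp only [dRel_optionEquivRight_some, permSum_dRel]
    rw [Finset.sum_filter, Fintype.sum_option]
    simp
  · rintro a - (i | b)
    · exact i.elim0
    · simp

theorem dSum_odd (m k : ℕ) :
    dSum (2 * m + 1) k = (X + (k : ℤ[X])) * dSum (2 * m) k := by
  rw [dSum_succ_left, permSum_option_of_twin]
  · simp only [dRel_optionEquivLeft_some, permSum_dRel]
    congr 1
    rw [Finset.sum_filter, Fintype.sum_option, Fintype.sum_sum_type]
    simp [(Fin.castSucc_lt_last _).not_ge]
  · rintro (j | a) h (i | b)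
    · simp [(Fin.castSucc_lt_last _).not_ge] at h
    · simp
    · simp [(Fin.castSucc_lt_last _).not_ge, Fin.le_last]
    · simp

theorem dRel_optionEquivLeft_iff (m k : ℕ) (x y : Option (Fin (2 * m + 1) ⊕ Fin k)) :
    dRel (2 * m + 2) k (optionEquivLeft _ k x) (optionEquivLeft _ k y) ↔
      dRel (2 * m + 1) (k + 1) (optionEquivRight _ k x) (optionEquivRight _ k y) ∧
        ∀ a, x = none → y ≠ some (.inr a) := by
  rcases x with _ | _ | _ <;> rcases y with _ | _ | _ <;>
    simp [(Fin.castSucc_lt_last _).not_ge, Fin.le_last]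

theorem dSum_even (m k : ℕ) :
    dSum (2 * m + 1) (k + 1) = dSum (2 * m + 2) k + k * dSum (2 * m + 1) k := by
  have h_inr : ∀ a : Fin k, (∑ σ : Equiv.Perm (Option (Fin (2 * m + 1) ⊕ Fin k)) with
      (∀ x, dRel (2 * m + 1) (k + 1) (optionEquivRight _ k x) (optionEquivRight _ k (σ x))) ∧
        σ none = some (.inr a), (X : ℤ[X]) ^ cycleCount σ) = dSum (2 * m + 1) k := by
    intro a
    rw [permSum_fiber (R := fun x y => dRel (2 * m + 1) (k + 1) (optionEquivRight _ k x)
      (optionEquivRight _ k y)) (some (.inr a)) (by simp)]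
    · simp only [dRel_optionEquivRight_some, permSum_dRel]
      simp
    · rintro _ ⟨⟩ (_ | _) <;> simp
  have h_iff : ∀ (i : Option (Fin (2 * m + 1) ⊕ Fin k))
      (σ : Equiv.Perm (Option (Fin (2 * m + 1) ⊕ Fin k))),
      ((∀ x, dRel (2 * m + 2) k (optionEquivLeft _ k x) (optionEquivLeft _ k (σ x))) ∧
        σ none = i) ↔
      ((∀ x, dRel (2 * m + 1) (k + 1) (optionEquivRight _ k x) (optionEquivRight _ k (σ x))) ∧
        σ none = i) ∧ ∀ a, i ≠ some (.inr a) := by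
    intro i σ
    simp only [dRel_optionEquivLeft_iff]
    constructor
    · rintro ⟨h, rfl⟩
      exact ⟨⟨fun x => (h x).1, rfl⟩, fun a => (h none).2 a rfl⟩
    · rintro ⟨⟨h, rfl⟩, h'⟩
      exact ⟨fun x => ⟨h x, by rintro a rfl; exact h' a⟩, rfl⟩
  rw [dSum_succ_right, dSum_succ_left (2 * m + 1), permSum_option, permSum_option,
    Fintype.sum_option, Fintype.sum_option, Fintype.sum_sum_type, Fintype.sum_sum_type]
  simp only [h_inr, h_iff]
  simp [add_assoc]

theorem dSum_recurrence (m k : ℕ) :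
    dSum (2 * (m + 1)) k =
      (X + (k : ℤ[X]) + 1) * dSum (2 * m) (k + 1) - (k : ℤ[X]) * (X + (k : ℤ[X])) * dSum (2 * m) k := by
  have h := dSum_even m k
  rw [dSum_odd, dSum_odd] at h
  push_cast at h
  rw [mul_add_one 2 m]
  linear_combination -h

end WildPoints

section Staircase

variable {R : Type*} [CommRing R]

/-- The total weight of the admissible values of a staircase on `2 * r + 2` points at position `i`
(counted from `0`), the values `2 * v + 2` with `v ∈ S` being forbidden: maxima have weight `x` or
`y` according to their parity, fixed points have weight `t`. -/
def posWeight (t : R) (r : ℕ) (x y : R) (S : Finset ℕ) (i : ℕ) : R :=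
  (if Even i then x else y) +
    ∑ v ∈ Finset.range r, if v ∉ S ∧ i ≤ 2 * v + 1 then (if i = 2 * v + 1 then t else 1) else 0

/-- The generating polynomial of surjective staircases on `2 * r + 2` points, in
inclusion-exclusion form. -/
def stairPoly (t : R) (r : ℕ) (x y : R) : R :=
  ∑ S ∈ (Finset.range r).powerset,
    (-1) ^ S.card * ∏ i ∈ Finset.range (2 * r), posWeight t r x y S i

theorem posWeight_succ_of_notMem (t : R) {r i : ℕ} (x y : R) {S : Finset ℕ} (hS : r ∉ S)
    (hi : i < 2 * r) : posWeight t (r + 1) x y S i = posWeight t r (x + 1) (y + 1) S i := by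
  rw [posWeight, posWeight, Finset.sum_range_succ, if_pos (c := r ∉ S ∧ i ≤ 2 * r + 1) ⟨hS, by lia⟩,
    if_neg (c := i = 2 * r + 1) (by lia)]
  split_ifs <;> ring

theorem posWeight_succ_insert (t : R) {r i : ℕ} (x y : R) (S : Finset ℕ) :
    posWeight t (r + 1) x y (insert r S) i = posWeight t r x y S i := by
  rw [posWeight, posWeight, Finset.sum_range_succ,
    if_neg (c := r ∉ insert r S ∧ i ≤ 2 * r + 1) (by simp), add_zero]
  congr 1
  refine Finset.sum_congr rfl fun v hv => ?_
  have : v ≠ r := (Finset.mem_range.1 hv).ne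
  simp [this]

theorem posWeight_of_le (t : R) {r i : ℕ} (x y : R) (S : Finset ℕ) (hi : 2 * r ≤ i) :
    posWeight t r x y S i = if Even i then x else y := by
  rw [posWeight, Finset.sum_eq_zero, add_zero]
  intro v hv
  rw [Finset.mem_range] at hv
  exact if_neg fun h => by lia

theorem stairPoly_zero (t x y : R) : stairPoly t 0 x y = 1 := by
  simp [stairPoly]

theorem stairPoly_succ (t : R) (r : ℕ) (x y : R) :
    stairPoly t (r + 1) x y =
      (x + 1) * (y + t) * stairPoly t r (x + 1) (y + 1) - x * y * stairPoly t r x y := by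
  have hr : ¬ Even (2 * r + 1) := by simp
  rw [stairPoly, Finset.range_add_one, Finset.sum_powerset_insert Finset.notMem_range_self,
    sub_eq_add_neg, stairPoly, stairPoly, Finset.mul_sum, ← neg_mul, Finset.mul_sum]
  congr 1 <;> refine Finset.sum_congr rfl fun S hS => ?_
  · have h_notMem : r ∉ S := fun h => by simpa using Finset.mem_powerset.1 hS h
    rw [mul_add_one, Finset.prod_range_succ, Finset.prod_range_succ,
      Finset.prod_congr rfl fun i hi => posWeight_succ_of_notMem t x y h_notMem (Finset.mem_range.1 hi)]
    have h0 : posWeight t (r + 1) x y S (2 * r) = x + 1 := by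
      rw [posWeight, Finset.sum_range_succ, Finset.sum_eq_zero, if_pos (by simp)]
      · simp [h_notMem]
      · intro v hv
        rw [Finset.mem_range] at hv
        exact if_neg fun h => by lia
    have h1 : posWeight t (r + 1) x y S (2 * r + 1) = y + t := by
      rw [posWeight, Finset.sum_range_succ, Finset.sum_eq_zero, if_neg hr]
      · simp [h_notMem]
      · intro v hv
        rw [Finset.mem_range] at hv
        exact if_neg fun h => by lia
    rw [h0, h1]
    ring
  · have h_notMem : r ∉ S := fun h => by simpa using Finset.mem_powerset.1 hS h
    simp only [posWeight_succ_insert]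
    rw [mul_add_one, Finset.prod_range_succ, Finset.prod_range_succ, posWeight_of_le _ _ _ _ le_rfl,
      posWeight_of_le _ _ _ _ (Nat.le_succ _), if_pos (by simp), if_neg hr,
      Finset.card_insert_of_notMem h_notMem]
    ring

end Staircase

section Comparison

open Polynomial

theorem dSum_eq_stairPoly (m k : ℕ) :
    dSum (2 * m) k = (∏ i ∈ Finset.range k, (X + (i : ℤ[X]))) *
      stairPoly X m (X + (k : ℤ[X])) (k : ℤ[X]) := by
  induction m generalizing k with
  | zero =>
    rw [stairPoly_zero, mul_one, mul_zero]
    induction k with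
    | zero => simp [dSum_zero_zero]
    | succ k ih => rw [dSum_zero_succ, ih, Finset.prod_range_succ, mul_comm]
  | succ m ih =>
    rw [dSum_recurrence, ih, ih, stairPoly_succ, Finset.prod_range_succ]
    push_cast
    rw [add_assoc X]
    ring

theorem sum_isDPerm (N : ℕ) :
    (∑ σ ∈ Finset.univ.filter
        fun σ : Equiv.Perm {x // x ∈ Finset.Icc 1 N} => IsDPerm (Finset.Icc 1 N) σ,
        (X : ℤ[X]) ^ cycleCount σ) = dSum N 0 := by
  let e : Fin N ⊕ Fin 0 ≃ {x // x ∈ Finset.Icc 1 N} :=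
    (Equiv.sumEmpty _ _).trans
      ⟨fun i => ⟨i + 1, by simp⟩, fun x => ⟨x - 1, by have := Finset.mem_Icc.1 x.2; lia⟩,
        fun i => by simp, fun x => by have := Finset.mem_Icc.1 x.2; ext; dsimp only; lia⟩
  have he : ∀ i, (e (.inl i) : ℕ) = i + 1 := fun _ => rfl
  symm
  refine (permSum_congr e (R' := fun x y => (Odd (x : ℕ) → (x : ℕ) ≤ y) ∧
    (Even (x : ℕ) → (y : ℕ) ≤ x)) ?_).trans ?_
  · rintro (i | i) (j | j)
    · simp only [he, dRel_inl_inl, Nat.odd_add_one, Nat.even_add_one, Fin.le_def]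
      simp
    all_goals first | exact i.elim0 | exact j.elim0
  · unfold permSum IsDPerm
    congr!

end Comparison

section Inclusion

open Polynomial

/-- The positions of a surjective staircase on `[2n+2]`. -/
abbrev StairPos (n : ℕ) : Type := {x // x ∈ Finset.Icc 1 (2 * n + 2)}

/-- The weight of the value `v` at position `i` in a surjective staircase on `[2n+2]` without even
maxima. -/
noncomputable def stairWeight (n i v : ℕ) : ℤ[X] :=
  if i ≤ v ∧ Even v then
    if i ≤ 2 * n then
      if v = 2 * n + 2 then (if Odd i then X else 0) else (if v = i then X else 1)
    else 1
  else 0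

theorem sum_Icc_two_mul {M : Type*} [AddCommMonoid M] (N : ℕ) (h : ℕ → M) :
    ∑ v ∈ Finset.Icc 1 (2 * N), h v = ∑ s ∈ Finset.range N, (h (2 * s + 1) + h (2 * s + 2)) := by
  induction N with
  | zero => simp
  | succ N ih =>
    rw [Finset.sum_range_succ, ← ih, mul_add_one, ← add_assoc, Finset.sum_Icc_succ_top (by lia),
      Finset.sum_Icc_succ_top (by lia), add_assoc]

theorem prod_Icc_one {M : Type*} [CommMonoid M] (N : ℕ) (h : ℕ → M) :
    ∏ v ∈ Finset.Icc 1 N, h v = ∏ i ∈ Finset.range N, h (i + 1) := by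
  induction N with
  | zero => simp
  | succ N ih => rw [Finset.prod_range_succ, ← ih, Finset.prod_Icc_succ_top (by lia)]

theorem sum_stairWeight (n i : ℕ) {S : Finset ℕ} (hS : S ⊆ Finset.range n) :
    (∑ v ∈ Finset.Icc 1 (2 * n + 2),
      stairWeight n (i + 1) v * if ∀ s ∈ S, v ≠ 2 * s + 2 then 1 else 0) =
    (∑ s ∈ Finset.range n, stairWeight n (i + 1) (2 * s + 2) * if s ∉ S then 1 else 0) +
      stairWeight n (i + 1) (2 * n + 2) := by
  have h_odd : ∀ s, stairWeight n (i + 1) (2 * s + 1) = 0 := fun s => if_neg (by simp)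
  have h_mem : ∀ s, (∀ r ∈ S, 2 * s + 2 ≠ 2 * r + 2) ↔ s ∉ S := fun s =>
    ⟨fun h hs => h s hs rfl, fun h r hr hs => h (by rwa [show s = r by lia])⟩
  have hn : n ∉ S := fun h => by simpa using hS h
  rw [show 2 * n + 2 = 2 * (n + 1) from rfl, sum_Icc_two_mul, Finset.sum_range_succ]
  simp only [h_odd, h_mem, zero_mul, zero_add]
  simp [hn, mul_add_one]

theorem sum_stairWeight_of_lt {n i : ℕ} (hi : i < 2 * n) {S : Finset ℕ}
    (hS : S ⊆ Finset.range n) :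
    (∑ v ∈ Finset.Icc 1 (2 * n + 2),
      stairWeight n (i + 1) v * if ∀ s ∈ S, v ≠ 2 * s + 2 then 1 else 0) =
    posWeight X n X 0 S i := by
  rw [sum_stairWeight n i hS, posWeight, add_comm]
  congr 1
  · rw [stairWeight, if_pos ⟨by lia, by simp [parity_simps]⟩, if_pos (by lia), if_pos rfl]
    simp [parity_simps]
  · refine Finset.sum_congr rfl fun v hv => ?_
    rw [Finset.mem_range] at hv
    have h_even : Even (2 * v + 2) := by simp [parity_simps]
    have h_ne : v ≠ n := hv.ne
    have h_eq : 2 * v + 2 = i + 1 ↔ i = 2 * v + 1 := by lia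
    have h_le : i + 1 ≤ 2 * v + 2 ↔ i ≤ 2 * v + 1 := by lia
    have h_lt : i + 1 ≤ 2 * n := hi
    by_cases hvS : v ∈ S <;> simp [stairWeight, h_even, h_ne, h_eq, h_le, h_lt, hvS]

theorem sum_stairWeight_of_le {n i : ℕ} (hi : 2 * n ≤ i) (hi' : i < 2 * n + 2) {S : Finset ℕ}
    (hS : S ⊆ Finset.range n) :
    (∑ v ∈ Finset.Icc 1 (2 * n + 2),
      stairWeight n (i + 1) v * if ∀ s ∈ S, v ≠ 2 * s + 2 then 1 else 0) = 1 := by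
  rw [sum_stairWeight n i hS, Finset.sum_eq_zero, zero_add, stairWeight,
    if_pos ⟨by lia, by simp [parity_simps]⟩, if_neg (by lia)]
  intro s hs
  rw [Finset.mem_range] at hs
  rw [stairWeight, if_neg (by lia), zero_mul]

theorem prod_sum_stairWeight (n : ℕ) {S : Finset ℕ} (hS : S ⊆ Finset.range n) :
    (∏ i : StairPos n, ∑ v : StairPos n,
      stairWeight n i v * if ∀ s ∈ S, (v : ℕ) ≠ 2 * s + 2 then 1 else 0) =
    ∏ i ∈ Finset.range (2 * n), posWeight X n X 0 S i := by
  have h : ∀ i : StairPos n, (∑ v : StairPos n,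
      stairWeight n i v * if ∀ s ∈ S, (v : ℕ) ≠ 2 * s + 2 then 1 else 0) =
      ∑ v ∈ Finset.Icc 1 (2 * n + 2),
        stairWeight n i v * if ∀ s ∈ S, v ≠ 2 * s + 2 then 1 else 0 := fun i =>
    Finset.sum_coe_sort (Finset.Icc 1 (2 * n + 2)) fun v =>
      stairWeight n i v * if ∀ s ∈ S, v ≠ 2 * s + 2 then 1 else 0
  simp only [h]
  rw [Finset.prod_coe_sort (Finset.Icc 1 (2 * n + 2)) fun i =>
    ∑ v ∈ Finset.Icc 1 (2 * n + 2),
      stairWeight n i v * if ∀ s ∈ S, v ≠ 2 * s + 2 then 1 else 0, prod_Icc_one,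
    Finset.prod_range_succ, Finset.prod_range_succ, sum_stairWeight_of_le le_rfl (by lia) hS,
    sum_stairWeight_of_le (Nat.le_succ _) (by lia) hS, mul_one, mul_one]
  exact Finset.prod_congr rfl fun i hi => sum_stairWeight_of_lt (Finset.mem_range.1 hi) hS

theorem inclusion_exclusion {R : Type*} [CommRing R] (U : Finset ℕ) (p : ℕ → Prop)
    [Decidable (∀ s ∈ U, p s)] :
    (if ∀ s ∈ U, p s then (1 : R) else 0) =
      ∑ S ∈ U.powerset, (-1) ^ S.card * if ∀ s ∈ S, ¬ p s then 1 else 0 := by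
  have h := congrArg (Int.cast : ℤ → R)
    (Finset.sum_powerset_neg_one_pow_card (x := U.filter fun s => ¬ p s))
  push_cast at h
  simp only [Finset.filter_eq_empty_iff, not_not] at h
  rw [← h]
  simp only [mul_ite, mul_one, mul_zero]
  rw [← Finset.sum_filter]
  refine Finset.sum_congr ?_ fun _ _ => rfl
  ext S
  simp only [Finset.mem_powerset, Finset.mem_filter, Finset.subset_iff]
  exact ⟨fun h => ⟨fun s hs => (h hs).1, fun s hs => (h hs).2⟩,
    fun h s hs => ⟨h.1 hs, h.2 s hs⟩⟩

theorem sum_prod_stairWeight (n : ℕ) :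
    (∑ f : StairPos n → StairPos n,
      (∏ i : StairPos n, stairWeight n i (f i)) *
        if ∀ s ∈ Finset.range n, ∃ i, (f i : ℕ) = 2 * s + 2 then 1 else 0) =
    stairPoly X n X 0 := by
  refine (Finset.sum_congr rfl fun f _ => by
    rw [inclusion_exclusion (Finset.range n) fun s => ∃ i : StairPos n, (f i : ℕ) = 2 * s + 2,
      Finset.mul_sum]).trans ?_
  rw [Finset.sum_comm, stairPoly]
  refine Finset.sum_congr rfl fun S hS => ?_
  rw [← prod_sum_stairWeight n (Finset.mem_powerset.1 hS), Finset.prod_univ_sum,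
    Fintype.piFinset_univ, Finset.mul_sum]
  refine Finset.sum_congr rfl fun f _ => ?_
  rw [Finset.prod_mul_distrib, mul_left_comm]
  congr 2
  rw [Finset.prod_ite_zero, Finset.prod_const_one]
  simp only [not_exists, Finset.mem_univ, true_imp_iff]
  exact if_congr ⟨fun h i s hs => h s hs i, fun h s hs i => h i s hs⟩ rfl rfl

theorem prod_ite_const_one {ι M : Type*} [CommMonoid M] (s : Finset ι) (p : ι → Prop)
    [DecidablePred p] (a : M) :
    (∏ i ∈ s, if p i then a else 1) = a ^ (s.filter p).card := by
  rw [Finset.prod_ite, Finset.prod_const, Finset.prod_const_one, mul_one]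

theorem prod_stairWeight (n : ℕ)
    (f : StairPos n → StairPos n)
    (hf : ∀ i : StairPos n, (i : ℕ) ≤ f i ∧ Even (f i : ℕ)) :
    ∏ i : StairPos n, stairWeight n i (f i) =
      if meCount n f = 0 then X ^ (moCount n f + fdCount n f + fiCount n f) else 0 := by
  have h : ∀ i : StairPos n, stairWeight n i (f i) =
      (if (i : ℕ) ≤ 2 * n ∧ Even (i : ℕ) ∧ (f i : ℕ) = 2 * n + 2 then 0 else 1) *
      ((if (i : ℕ) ≤ 2 * n ∧ Odd (i : ℕ) ∧ (f i : ℕ) = 2 * n + 2 then X else 1) *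
      (if (i : ℕ) ≤ 2 * n ∧ f i = i ∧ ∃ j, j ≠ i ∧ f j = i then X else 1) *
      (if (i : ℕ) ≤ 2 * n ∧ f i = i ∧ ∀ j, f j = i → j = i then X else 1)) := by
    intro i
    have h_ex : (∃ j, j ≠ i ∧ f j = i) ↔ ¬ ∀ j, f j = i → j = i := by
      push Not
      exact exists_congr fun j => and_comm
    have h_coe : (f i : ℕ) = i ↔ f i = i := Subtype.ext_iff.symm
    rw [stairWeight, if_pos (hf i)]
    simp only [h_ex, ← Nat.not_odd_iff_even, ← h_coe]
    by_cases h1 : (i : ℕ) ≤ 2 * n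
    · by_cases h2 : (f i : ℕ) = 2 * n + 2
      · have : (f i : ℕ) ≠ i := by lia
        by_cases h3 : Odd (i : ℕ) <;> simp [h1, h2, h3, show 2 * n + 2 ≠ (i : ℕ) by lia]
      · by_cases h3 : (f i : ℕ) = i
        · have h_ne : (i : ℕ) ≠ 2 * n + 2 := by lia
          by_cases h4 : ∀ j, f j = i → j = i
          · simp only [eq_true h4]
            simp [h1, h3, h_ne]
          · simp only [eq_false h4]
            simp [h1, h3, h_ne]
        · simp [h1, h2, h3]
    · simp [h1]
  simp only [h, Finset.prod_mul_distrib, prod_ite_const_one, ← pow_add]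
  rw [zero_pow_eq, ite_mul, one_mul, zero_mul]
  unfold meCount moCount fdCount fiCount
  congr!

theorem isSurjStaircase_iff (n : ℕ)
    (f : StairPos n → StairPos n) :
    IsSurjStaircase (2 * n + 2) f ↔ (∀ i : StairPos n, (i : ℕ) ≤ f i ∧ Even (f i : ℕ)) ∧
      ∀ s ∈ Finset.range n, ∃ i, (f i : ℕ) = 2 * s + 2 := by
  constructor
  · rintro ⟨h_le, h_im⟩
    refine ⟨fun i => ⟨h_le i, (h_im _).2 ⟨i, rfl⟩⟩, fun s hs => ?_⟩
    rw [Finset.mem_range] at hs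
    obtain ⟨i, hi⟩ := (h_im ⟨2 * s + 2, Finset.mem_Icc.2 (by lia)⟩).1 (by simp [parity_simps])
    exact ⟨i, by rw [hi]⟩
  · rintro ⟨h, h_im⟩
    refine ⟨fun i => (h i).1, fun j => ⟨fun hj => ?_, ?_⟩⟩
    · have hj' := Finset.mem_Icc.1 j.2
      obtain ⟨s, hs⟩ := hj
      by_cases hjn : (j : ℕ) = 2 * n + 2
      · refine ⟨j, Subtype.ext ?_⟩
        have := (h j).1
        have := (Finset.mem_Icc.1 (f j).2).2
        lia
      · obtain ⟨i, hi⟩ := h_im (s - 1) (Finset.mem_range.2 (by lia))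
        exact ⟨i, Subtype.ext (by lia)⟩
    · rintro ⟨i, rfl⟩
      exact (h i).2

theorem sum_isSurjStaircase (n : ℕ) :
    (∑ f ∈ Finset.univ.filter
        fun f : {x // x ∈ Finset.Icc 1 (2 * n + 2)} → {x // x ∈ Finset.Icc 1 (2 * n + 2)} =>
          IsSurjStaircase (2 * n + 2) f ∧ meCount n f = 0,
        (X : ℤ[X]) ^ (moCount n f + fdCount n f + fiCount n f)) = stairPoly X n X 0 := by
  rw [← sum_prod_stairWeight, Finset.sum_filter]
  refine Finset.sum_congr rfl fun f _ => ?_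
  rw [isSurjStaircase_iff]
  by_cases hf : ∀ i : StairPos n, (i : ℕ) ≤ f i ∧ Even (f i : ℕ)
  · rw [prod_stairWeight n f hf]
    by_cases h1 : ∀ s ∈ Finset.range n, ∃ i, (f i : ℕ) = 2 * s + 2 <;>
      by_cases h2 : meCount n f = 0 <;> simp only [hf, h1, h2] <;> simp
  · obtain ⟨i, hi⟩ := not_forall.1 hf
    rw [if_neg fun h => hf h.1.1, Finset.prod_eq_zero (Finset.mem_univ i) (if_neg hi), zero_mul]

end Inclusion

open Polynomial in
/-- `Σ_{σ ∈ D_{2n}} t^{c(σ)} = Σ_f t^{mo(f)+fd(f)+fi(f)}`, the right sum being over all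
surjective staircases `f` on `[2n+2]` with no even maxima. -/
theorem stmt16 (n : ℕ) (hn : 1 ≤ n) :
    (∑ σ ∈ Finset.univ.filter
        fun σ : Equiv.Perm {x // x ∈ Finset.Icc 1 (2 * n)} =>
          IsDPerm (Finset.Icc 1 (2 * n)) σ,
        (Polynomial.X : Polynomial ℤ) ^ cycleCount σ) =
      ∑ f ∈ Finset.univ.filter
        fun f : {x // x ∈ Finset.Icc 1 (2 * n + 2)} → {x // x ∈ Finset.Icc 1 (2 * n + 2)} =>
          IsSurjStaircase (2 * n + 2) f ∧ meCount n f = 0,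
        (Polynomial.X : Polynomial ℤ) ^ (moCount n f + fdCount n f + fiCount n f) := by
  rw [sum_isDPerm, sum_isSurjStaircase, dSum_eq_stairPoly]
  simp
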